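/- arXiv:0808.0317 — 11 statements merged into one kernel-verified Lean document; each statement's English description precedes it below -/
import Mathlib

section
/- Let ν > 0, let y > 0, and let g : (0,∞) → ℝ be measurable such that the function (u,x) ↦ u^(2ν−1)·exp(−y²u²)·x·exp(−x²u²)·|g(x)| is integrable on (0,∞) × (0,∞). Then ∫₀^∞ u^(2ν−1)·exp(−y²u²)·L₂{g}(u) du = (Γ(ν)/2)·P_{ν,2}{g}(y); that is, the L₂-transform of u ↦ u^(2ν−2)·L₂{g}(u) evaluated at y equals (Γ(ν)/2) times the P_{ν,2}-transform of g at y. -/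
open MeasureTheory Real Set

/-- The Gaussian moment `∫₀^∞ u^(2ν-1) exp(-b u²) du`. -/
theorem integral_rpow_mul_exp_neg_mul_sq_Ioi {ν b : ℝ} (hν : 0 < ν) (hb : 0 < b) :
    ∫ u in Ioi (0 : ℝ), u ^ (2 * ν - 1) * Real.exp (-b * u ^ 2) = Real.Gamma ν / 2 / b ^ ν := by
  have h := integral_rpow_mul_exp_neg_mul_rpow (p := 2) (q := 2 * ν - 1) two_pos
    (by linarith) hb
  have hexp : -(2 * ν - 1 + 1) / 2 = -ν := by ring
  have harg : (2 * ν - 1 + 1) / 2 = ν := by ring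
  simp only [Real.rpow_two] at h
  rw [h, hexp, harg, Real.rpow_neg hb.le]
  ring

/-- Iteration identity: the `L₂`-transform of `u ↦ u^(2ν-2) · L₂{g}(u)` at `y`
equals `Γ(ν)/2` times the `P_{ν,2}`-transform of `g` at `y`. -/
theorem L2_iteration_eq_Pnu2 (ν y : ℝ) (hν : 0 < ν) (hy : 0 < y) (g : ℝ → ℝ)
    (hg : AEMeasurable g (volume.restrict (Ioi 0)))
    (hint : IntegrableOn
      (fun p : ℝ × ℝ =>
        p.1 ^ (2 * ν - 1) * Real.exp (-(y ^ 2) * p.1 ^ 2) *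
          (p.2 * Real.exp (-(p.2 ^ 2) * p.1 ^ 2) * |g p.2|))
      (Ioi 0 ×ˢ Ioi 0)) :
    ∫ u in Ioi (0 : ℝ),
        u ^ (2 * ν - 1) * Real.exp (-(y ^ 2) * u ^ 2) *
          ∫ x in Ioi (0 : ℝ), x * Real.exp (-(x ^ 2) * u ^ 2) * g x
      = Real.Gamma ν / 2 *
          ∫ x in Ioi (0 : ℝ), x * g x / (x ^ 2 + y ^ 2) ^ ν := by
  have hF : Integrable (Function.uncurry fun u x : ℝ =>
      u ^ (2 * ν - 1) * Real.exp (-(y ^ 2) * u ^ 2) * (x * Real.exp (-(x ^ 2) * u ^ 2) * g x))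
      ((volume.restrict (Ioi 0)).prod (volume.restrict (Ioi 0))) := by
    rw [IntegrableOn, Measure.volume_eq_prod, ← Measure.prod_restrict] at hint
    refine hint.mono ?_ (Filter.Eventually.of_forall fun p => ?_)
    · have hg' : AEMeasurable (fun p : ℝ × ℝ => g p.2)
          ((volume.restrict (Ioi 0)).prod (volume.restrict (Ioi 0))) :=
        hg.comp_quasiMeasurePreserving Measure.quasiMeasurePreserving_snd
      have hk : Measurable fun p : ℝ × ℝ =>
          p.1 ^ (2 * ν - 1) * Real.exp (-(y ^ 2) * p.1 ^ 2) := by fun_prop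
      have hl : Measurable fun p : ℝ × ℝ => p.2 * Real.exp (-(p.2 ^ 2) * p.1 ^ 2) := by fun_prop
      exact (hk.aemeasurable.mul (hl.aemeasurable.mul hg')).aestronglyMeasurable
    · simp [Function.uncurry]
  simp_rw [← integral_const_mul]
  rw [integral_integral_swap hF]
  refine setIntegral_congr_fun measurableSet_Ioi fun x _ => ?_
  have hb : 0 < x ^ 2 + y ^ 2 := by positivity
  calc
    _ = ∫ u in Ioi (0 : ℝ),
          x * g x * (u ^ (2 * ν - 1) * Real.exp (-(x ^ 2 + y ^ 2) * u ^ 2)) := by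
      congr 1 with u
      have hexp : -(x ^ 2 + y ^ 2) * u ^ 2 = -(y ^ 2) * u ^ 2 + -(x ^ 2) * u ^ 2 := by ring
      rw [hexp, Real.exp_add]
      ring
    _ = _ := by
      rw [integral_const_mul, integral_rpow_mul_exp_neg_mul_sq_Ioi hν hb]
      ring
end

section
/- Let ν > 0 and let f, g : (0,∞) → ℝ be measurable such that the function (x,u,y) ↦ y^(2ν−1)·x·exp(−x²y²)·|f(x)|·u·exp(−u²y²)·|g(u)| is integrable on (0,∞)³. Then ∫₀^∞ y^(2ν−1)·L₂{f}(y)·L₂{g}(y) dy = (Γ(ν)/2)·∫₀^∞ x·f(x)·P_{ν,2}{g}(x) dx. -/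
open MeasureTheory Real Set

/-- The Gamma-type integral with the Gaussian weight split as a product. -/
lemma integral_rpow_mul_exp_mul_exp {ν x u : ℝ} (hν : 0 < ν) (hx : 0 < x) :
    ∫ y in Ioi (0 : ℝ),
        y ^ (2 * ν - 1) * (Real.exp (-(x ^ 2) * y ^ 2) * Real.exp (-(u ^ 2) * y ^ 2))
      = Real.Gamma ν / 2 / (u ^ 2 + x ^ 2) ^ ν := by
  have hb : 0 < u ^ 2 + x ^ 2 := by positivity
  have h := integral_rpow_mul_exp_neg_mul_rpow (p := 2) (q := 2 * ν - 1) two_pos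
    (by linarith) hb
  have e₁ : (2 * ν - 1 + 1) / 2 = ν := by ring
  have e₂ : -(2 * ν - 1 + 1) / 2 = -ν := by ring
  rw [e₁, e₂, Real.rpow_neg hb.le] at h
  calc
    _ = ∫ y in Ioi (0 : ℝ), y ^ (2 * ν - 1) * Real.exp (-(u ^ 2 + x ^ 2) * y ^ (2 : ℝ)) := by
      congr 1 with y
      rw [← Real.exp_add, Real.rpow_two]
      ring_nf
    _ = _ := by
      rw [h]
      ring

/-- Integrability of the absolute values gives integrability of the signed triple kernel. -/
lemma integrable_parseval_kernel {ν : ℝ} {f g : ℝ → ℝ}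
    (hf : AEMeasurable f (volume.restrict (Ioi 0)))
    (hg : AEMeasurable g (volume.restrict (Ioi 0)))
    (hint : IntegrableOn
      (fun p : ℝ × ℝ × ℝ =>
        p.2.2 ^ (2 * ν - 1) * (p.1 * Real.exp (-(p.1 ^ 2) * p.2.2 ^ 2) * |f p.1|) *
          (p.2.1 * Real.exp (-(p.2.1 ^ 2) * p.2.2 ^ 2) * |g p.2.1|))
      (Ioi 0 ×ˢ Ioi 0 ×ˢ Ioi 0)) :
    Integrable
      (fun p : ℝ × ℝ × ℝ =>
        p.2.2 ^ (2 * ν - 1) * (p.1 * Real.exp (-(p.1 ^ 2) * p.2.2 ^ 2) * f p.1) *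
          (p.2.1 * Real.exp (-(p.2.1 ^ 2) * p.2.2 ^ 2) * g p.2.1))
      ((volume.restrict (Ioi 0)).prod
        ((volume.restrict (Ioi 0)).prod (volume.restrict (Ioi 0)))) := by
  rw [IntegrableOn, Measure.volume_eq_prod, ← Measure.prod_restrict, Measure.volume_eq_prod,
    ← Measure.prod_restrict] at hint
  refine hint.mono (AEMeasurable.aestronglyMeasurable ?_) (.of_forall fun p => by simp)
  have hf' : AEMeasurable (fun p : ℝ × ℝ × ℝ => f p.1) ((volume.restrict (Ioi 0)).prod
      ((volume.restrict (Ioi 0)).prod (volume.restrict (Ioi 0)))) :=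
    hf.comp_quasiMeasurePreserving Measure.quasiMeasurePreserving_fst
  have hg' : AEMeasurable (fun p : ℝ × ℝ × ℝ => g p.2.1) ((volume.restrict (Ioi 0)).prod
      ((volume.restrict (Ioi 0)).prod (volume.restrict (Ioi 0)))) :=
    hg.comp_quasiMeasurePreserving
      (Measure.quasiMeasurePreserving_fst.comp Measure.quasiMeasurePreserving_snd)
  have hx : AEMeasurable (fun p : ℝ × ℝ × ℝ =>
      p.2.2 ^ (2 * ν - 1) * (p.1 * Real.exp (-(p.1 ^ 2) * p.2.2 ^ 2)))
      ((volume.restrict (Ioi 0)).prod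
        ((volume.restrict (Ioi 0)).prod (volume.restrict (Ioi 0)))) := by
    fun_prop
  have hu : AEMeasurable (fun p : ℝ × ℝ × ℝ => p.2.1 * Real.exp (-(p.2.1 ^ 2) * p.2.2 ^ 2))
      ((volume.restrict (Ioi 0)).prod
        ((volume.restrict (Ioi 0)).prod (volume.restrict (Ioi 0)))) := by
    fun_prop
  simpa only [mul_assoc, Pi.mul_def] using (hx.mul hf').mul (hu.mul hg')

/-- Parseval–Goldstein type relation:
`∫₀^∞ y^(2ν-1) L₂{f}(y) L₂{g}(y) dy = (Γ(ν)/2) ∫₀^∞ x f(x) P_{ν,2}{g}(x) dx`. -/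
theorem parseval_goldstein_L2_Pnu2_left (ν : ℝ) (hν : 0 < ν) (f g : ℝ → ℝ)
    (hf : AEMeasurable f (volume.restrict (Ioi 0)))
    (hg : AEMeasurable g (volume.restrict (Ioi 0)))
    (hint : IntegrableOn
      (fun p : ℝ × ℝ × ℝ =>
        p.2.2 ^ (2 * ν - 1) * (p.1 * Real.exp (-(p.1 ^ 2) * p.2.2 ^ 2) * |f p.1|) *
          (p.2.1 * Real.exp (-(p.2.1 ^ 2) * p.2.2 ^ 2) * |g p.2.1|))
      (Ioi 0 ×ˢ Ioi 0 ×ˢ Ioi 0)) :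
    ∫ y in Ioi (0 : ℝ),
        y ^ (2 * ν - 1) * (∫ x in Ioi (0 : ℝ), x * Real.exp (-(x ^ 2) * y ^ 2) * f x) *
          ∫ u in Ioi (0 : ℝ), u * Real.exp (-(u ^ 2) * y ^ 2) * g u
      = Real.Gamma ν / 2 *
          ∫ x in Ioi (0 : ℝ),
            x * f x * ∫ u in Ioi (0 : ℝ), u * g u / (u ^ 2 + x ^ 2) ^ ν := by
  have hF := integrable_parseval_kernel hf hg hint
  set μ : Measure ℝ := volume.restrict (Ioi 0) with hμ
  set F : ℝ × ℝ × ℝ → ℝ := fun p =>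
    p.2.2 ^ (2 * ν - 1) * (p.1 * Real.exp (-(p.1 ^ 2) * p.2.2 ^ 2) * f p.1) *
      (p.2.1 * Real.exp (-(p.2.1 ^ 2) * p.2.2 ^ 2) * g p.2.1) with hFdef
  have hassoc : MeasurePreserving (MeasurableEquiv.prodAssoc : (ℝ × ℝ) × ℝ ≃ᵐ ℝ × ℝ × ℝ)
      ((μ.prod μ).prod μ) (μ.prod (μ.prod μ)) := measurePreserving_prodAssoc μ μ μ
  have hF' : Integrable (fun q : (ℝ × ℝ) × ℝ => F (MeasurableEquiv.prodAssoc q))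
      ((μ.prod μ).prod μ) :=
    (hassoc.integrable_comp_emb MeasurableEquiv.prodAssoc.measurableEmbedding).2 hF
  have hleft : ∫ p, F p ∂(μ.prod (μ.prod μ)) = ∫ y, y ^ (2 * ν - 1) *
      (∫ x, x * Real.exp (-(x ^ 2) * y ^ 2) * f x ∂μ) *
        (∫ u, u * Real.exp (-(u ^ 2) * y ^ 2) * g u ∂μ) ∂μ := by
    rw [← hassoc.integral_comp MeasurableEquiv.prodAssoc.measurableEmbedding,
      integral_prod_symm _ hF']
    congr 1 with y
    rw [← integral_const_mul (y ^ (2 * ν - 1)), ← integral_prod_mul]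
    rfl
  have hright : ∫ p, F p ∂(μ.prod (μ.prod μ)) = ∫ x, Real.Gamma ν / 2 *
      (x * f x * ∫ u, u * g u / (u ^ 2 + x ^ 2) ^ ν ∂μ) ∂μ := by
    rw [integral_prod _ hF]
    refine integral_congr_ae ?_
    filter_upwards [hF.prod_right_ae, ae_restrict_mem measurableSet_Ioi] with x hFx hx
    rw [integral_prod _ hFx, ← integral_const_mul, ← integral_const_mul]
    congr 1 with u
    calc
      _ = ∫ y, (x * f x * (u * g u)) * (y ^ (2 * ν - 1) *
            (Real.exp (-(x ^ 2) * y ^ 2) * Real.exp (-(u ^ 2) * y ^ 2))) ∂μ := by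
        congr 1 with y
        simp only [hFdef]
        ring
      _ = _ := by
        rw [integral_const_mul, hμ, integral_rpow_mul_exp_mul_exp hν hx]
        ring
  rw [← hleft, hright, integral_const_mul]
end

section
/- Let ν > 0 and let f, g : (0,∞) → ℝ be measurable such that the function (x,u,y) ↦ y^(2ν−1)·x·exp(−x²y²)·|f(x)|·u·exp(−u²y²)·|g(u)| is integrable on (0,∞)³. Then ∫₀^∞ y^(2ν−1)·L₂{f}(y)·L₂{g}(y) dy = (Γ(ν)/2)·∫₀^∞ u·g(u)·P_{ν,2}{f}(u) du. -/
open MeasureTheory Real Set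

/-- The Gaussian moment integral `∫₀^∞ y^(2ν-1) exp(-b y²) dy = Γ(ν) / (2 b^ν)`. -/
theorem integral_rpow_mul_exp_neg_mul_sq {ν b : ℝ} (hν : 0 < ν) (hb : 0 < b) :
    ∫ y in Ioi (0 : ℝ), y ^ (2 * ν - 1) * Real.exp (-b * y ^ 2)
      = Real.Gamma ν / 2 / b ^ ν := by
  have h := integral_rpow_mul_exp_neg_mul_rpow (p := 2) (q := 2 * ν - 1) (b := b)
    two_pos (by linarith) hb
  have hq : (2 * ν - 1 + 1) / 2 = ν := by ring
  have hq' : -(2 * ν - 1 + 1) / 2 = -ν := by ring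
  simp only [Real.rpow_two, hq, hq', Real.rpow_neg hb.le] at h
  rw [h]
  ring

/-- Parseval–Goldstein type relation:
`∫₀^∞ y^(2ν-1) L₂{f}(y) L₂{g}(y) dy = (Γ(ν)/2) ∫₀^∞ u g(u) P_{ν,2}{f}(u) du`. -/
theorem parseval_goldstein_L2_Pnu2_right (ν : ℝ) (hν : 0 < ν) (f g : ℝ → ℝ)
    (hf : AEMeasurable f (volume.restrict (Ioi 0)))
    (hg : AEMeasurable g (volume.restrict (Ioi 0)))
    (hint : IntegrableOn
      (fun p : ℝ × ℝ × ℝ =>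
        p.2.2 ^ (2 * ν - 1) * (p.1 * Real.exp (-(p.1 ^ 2) * p.2.2 ^ 2) * |f p.1|) *
          (p.2.1 * Real.exp (-(p.2.1 ^ 2) * p.2.2 ^ 2) * |g p.2.1|))
      (Ioi 0 ×ˢ Ioi 0 ×ˢ Ioi 0)) :
    ∫ y in Ioi (0 : ℝ),
        y ^ (2 * ν - 1) * (∫ x in Ioi (0 : ℝ), x * Real.exp (-(x ^ 2) * y ^ 2) * f x) *
          ∫ u in Ioi (0 : ℝ), u * Real.exp (-(u ^ 2) * y ^ 2) * g u
      = Real.Gamma ν / 2 *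
          ∫ u in Ioi (0 : ℝ),
            u * g u * ∫ x in Ioi (0 : ℝ), x * f x / (x ^ 2 + u ^ 2) ^ ν := by
  set μ : Measure ℝ := volume.restrict (Ioi 0) with hμ
  let F : (ℝ × ℝ) × ℝ → ℝ := fun p =>
    p.2 ^ (2 * ν - 1) * (p.1.1 * Real.exp (-(p.1.1 ^ 2) * p.2 ^ 2) * f p.1.1) *
      (p.1.2 * Real.exp (-(p.1.2 ^ 2) * p.2 ^ 2) * g p.1.2)
  have hF : Integrable F ((μ.prod μ).prod μ) := by
    rw [IntegrableOn, Measure.volume_eq_prod, Measure.volume_eq_prod,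
      ← Measure.prod_restrict, ← Measure.prod_restrict, ← hμ] at hint
    have habs := (measurePreserving_prodAssoc μ μ μ).integrable_comp_of_integrable hint
    have hf' : AEMeasurable (fun p : (ℝ × ℝ) × ℝ => f p.1.1) ((μ.prod μ).prod μ) :=
      (hf.comp_fst (ν := μ)).comp_fst
    have hg' : AEMeasurable (fun p : (ℝ × ℝ) × ℝ => g p.1.2) ((μ.prod μ).prod μ) :=
      (hg.comp_snd (μ := μ)).comp_fst
    refine habs.mono (AEMeasurable.aestronglyMeasurable (by fun_prop)) (ae_of_all _ fun p => ?_)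
    simp [F, MeasurableEquiv.prodAssoc]
  have hL : ∀ y : ℝ, y ^ (2 * ν - 1) * (∫ x, x * Real.exp (-(x ^ 2) * y ^ 2) * f x ∂μ) *
      (∫ u, u * Real.exp (-(u ^ 2) * y ^ 2) * g u ∂μ) = ∫ p, F (p, y) ∂(μ.prod μ) := by
    intro y
    rw [← integral_const_mul (y ^ (2 * ν - 1)), ← integral_prod_mul]
  have hR : ∀ u ∈ Ioi (0 : ℝ), Real.Gamma ν / 2 *
      (u * g u * ∫ x, x * f x / (x ^ 2 + u ^ 2) ^ ν ∂μ) = ∫ x, ∫ y, F ((x, u), y) ∂μ ∂μ := by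
    intro u hu
    rw [← integral_const_mul, ← integral_const_mul]
    refine integral_congr_ae (ae_of_all _ fun x => ?_)
    have hb : 0 < x ^ 2 + u ^ 2 := add_pos_of_nonneg_of_pos (sq_nonneg x) (pow_pos hu 2)
    have hFy : ∀ y, F ((x, u), y) =
        x * f x * (u * g u) * (y ^ (2 * ν - 1) * Real.exp (-(x ^ 2 + u ^ 2) * y ^ 2)) := by
      intro y
      have he : Real.exp (-(x ^ 2 + u ^ 2) * y ^ 2) =
          Real.exp (-(x ^ 2) * y ^ 2) * Real.exp (-(u ^ 2) * y ^ 2) := by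
        rw [← Real.exp_add]
        ring_nf
      rw [he]
      ring
    simp only [hFy]
    rw [integral_const_mul, integral_rpow_mul_exp_neg_mul_sq hν hb]
    ring
  calc _ = ∫ y, ∫ p, F (p, y) ∂(μ.prod μ) ∂μ := by simp only [hL]
    _ = ∫ p, ∫ y, F (p, y) ∂μ ∂(μ.prod μ) := by
      rw [← integral_prod_symm _ hF, integral_prod _ hF]
    _ = ∫ u, ∫ x, ∫ y, F ((x, u), y) ∂μ ∂μ ∂μ := integral_prod_symm _ hF.integral_prod_left
    _ = _ := by
      rw [← integral_const_mul]
      exact (setIntegral_congr_fun measurableSet_Ioi hR).symm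
end

section
/- Let f, g : (0,∞) → ℝ be measurable such that the function (x,u,y) ↦ y·x·exp(−x²y²)·|f(x)|·u·exp(−u²y²)·|g(u)| is integrable on (0,∞)³. Then ∫₀^∞ y·L₂{f}(y)·L₂{g}(y) dy = (1/2)·∫₀^∞ x·f(x)·P{g}(x) dx. -/
open MeasureTheory Real Set

/-- The Gaussian moment `∫₀^∞ y exp(-b y²) dy = 1 / (2b)`. -/
lemma integral_Ioi_mul_exp_neg_mul_sq {b : ℝ} (hb : 0 < b) :
    ∫ y in Ioi (0 : ℝ), y * Real.exp (-b * y ^ 2) = 1 / (2 * b) := by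
  have h := integral_rpow_mul_exp_neg_mul_rpow (p := 2) (q := 1) (b := b)
    (by norm_num) (by norm_num) hb
  norm_num at h
  simp only [neg_mul]
  rw [h, Real.rpow_neg_one]
  field_simp

/-- The signed version of the triple integrand is integrable as soon as its absolute value is. -/
lemma integrable_triple_kernel_of_abs (f g : ℝ → ℝ)
    (hf : AEMeasurable f (volume.restrict (Ioi 0)))
    (hg : AEMeasurable g (volume.restrict (Ioi 0)))
    (hint : IntegrableOn
      (fun p : ℝ × ℝ × ℝ =>
        p.2.2 * (p.1 * Real.exp (-(p.1 ^ 2) * p.2.2 ^ 2) * |f p.1|) *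
          (p.2.1 * Real.exp (-(p.2.1 ^ 2) * p.2.2 ^ 2) * |g p.2.1|))
      (Ioi 0 ×ˢ Ioi 0 ×ˢ Ioi 0)) :
    Integrable
      (fun p : ℝ × ℝ × ℝ =>
        p.2.2 * (p.1 * Real.exp (-(p.1 ^ 2) * p.2.2 ^ 2) * f p.1) *
          (p.2.1 * Real.exp (-(p.2.1 ^ 2) * p.2.2 ^ 2) * g p.2.1))
      ((volume.restrict (Ioi 0)).prod
        ((volume.restrict (Ioi 0)).prod (volume.restrict (Ioi 0)))) := by
  have hμ : (volume : Measure (ℝ × ℝ × ℝ)).restrict (Ioi 0 ×ˢ Ioi 0 ×ˢ Ioi 0) =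
      (volume.restrict (Ioi 0)).prod
        ((volume.restrict (Ioi 0)).prod (volume.restrict (Ioi 0))) := by
    simp only [Measure.volume_eq_prod, Measure.prod_restrict]
  rw [IntegrableOn, hμ] at hint
  have hf' := hf.comp_quasiMeasurePreserving (Measure.quasiMeasurePreserving_fst
    (ν := (volume.restrict (Ioi (0 : ℝ))).prod (volume.restrict (Ioi (0 : ℝ)))))
  have hg' := (hg.comp_quasiMeasurePreserving (Measure.quasiMeasurePreserving_fst
    (ν := volume.restrict (Ioi (0 : ℝ))))).comp_quasiMeasurePreserving
      (Measure.quasiMeasurePreserving_snd (μ := volume.restrict (Ioi (0 : ℝ))))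
  refine hint.mono (AEMeasurable.aestronglyMeasurable ?_) (.of_forall fun p => ?_)
  · refine AEMeasurable.mul (AEMeasurable.mul (by fun_prop) (AEMeasurable.mul ?_ hf'))
      (AEMeasurable.mul ?_ hg') <;> fun_prop
  · simp only [norm_mul, Real.norm_eq_abs, abs_abs, le_refl]

/-- Parseval–Goldstein type relation:
`∫₀^∞ y L₂{f}(y) L₂{g}(y) dy = (1/2) ∫₀^∞ x f(x) P{g}(x) dx`,
where `P` is the Widder potential transform. -/
theorem parseval_goldstein_L2_widder_left (f g : ℝ → ℝ)
    (hf : AEMeasurable f (volume.restrict (Ioi 0)))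
    (hg : AEMeasurable g (volume.restrict (Ioi 0)))
    (hint : IntegrableOn
      (fun p : ℝ × ℝ × ℝ =>
        p.2.2 * (p.1 * Real.exp (-(p.1 ^ 2) * p.2.2 ^ 2) * |f p.1|) *
          (p.2.1 * Real.exp (-(p.2.1 ^ 2) * p.2.2 ^ 2) * |g p.2.1|))
      (Ioi 0 ×ˢ Ioi 0 ×ˢ Ioi 0)) :
    ∫ y in Ioi (0 : ℝ),
        y * (∫ x in Ioi (0 : ℝ), x * Real.exp (-(x ^ 2) * y ^ 2) * f x) *
          ∫ u in Ioi (0 : ℝ), u * Real.exp (-(u ^ 2) * y ^ 2) * g u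
      = (1 / 2) *
          ∫ x in Ioi (0 : ℝ),
            x * f x * ∫ u in Ioi (0 : ℝ), u * g u / (u ^ 2 + x ^ 2) := by
  set μ : Measure ℝ := volume.restrict (Ioi 0) with hμ
  have hF := integrable_triple_kernel_of_abs f g hf hg hint
  rw [← hμ] at hF
  set F : ℝ × ℝ × ℝ → ℝ := fun p =>
    p.2.2 * (p.1 * Real.exp (-(p.1 ^ 2) * p.2.2 ^ 2) * f p.1) *
      (p.2.1 * Real.exp (-(p.2.1 ^ 2) * p.2.2 ^ 2) * g p.2.1) with hFdef
  have hassoc : MeasurePreserving (MeasurableEquiv.prodAssoc (α := ℝ) (β := ℝ) (γ := ℝ))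
      ((μ.prod μ).prod μ) (μ.prod (μ.prod μ)) := measurePreserving_prodAssoc μ μ μ
  have hF' : Integrable (fun q : (ℝ × ℝ) × ℝ => F (q.1.1, q.1.2, q.2)) ((μ.prod μ).prod μ) :=
    hassoc.integrable_comp_of_integrable hF
  have hleft : ∫ p, F p ∂μ.prod (μ.prod μ) =
      ∫ y, y * (∫ x, x * Real.exp (-(x ^ 2) * y ^ 2) * f x ∂μ) *
        (∫ u, u * Real.exp (-(u ^ 2) * y ^ 2) * g u ∂μ) ∂μ := by
    rw [← hassoc.integral_comp', show
      (∫ q, F (MeasurableEquiv.prodAssoc q) ∂(μ.prod μ).prod μ) =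
        ∫ q : (ℝ × ℝ) × ℝ, F (q.1.1, q.1.2, q.2) ∂(μ.prod μ).prod μ from rfl,
      integral_prod_symm _ hF']
    refine integral_congr_ae (.of_forall fun y => ?_)
    simp only [hFdef]
    rw [mul_assoc, ← integral_prod_mul, ← integral_const_mul]
    simp only [mul_assoc]
  have hright : ∫ p, F p ∂μ.prod (μ.prod μ) =
      (1 / 2) * ∫ x, x * f x * ∫ u, u * g u / (u ^ 2 + x ^ 2) ∂μ ∂μ := by
    rw [integral_prod _ hF, ← integral_const_mul]
    refine integral_congr_ae ?_
    filter_upwards [hF.prod_right_ae, ae_restrict_mem measurableSet_Ioi] with x hx hx0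
    rw [integral_prod _ hx, ← mul_assoc, ← integral_const_mul]
    refine integral_congr_ae ?_
    filter_upwards [ae_restrict_mem measurableSet_Ioi] with u hu0
    have hx0 : 0 < x := hx0
    have hu0 : 0 < u := hu0
    have hpos : 0 < u ^ 2 + x ^ 2 := by positivity
    calc ∫ y, F (x, u, y) ∂μ
        = ∫ y, (x * f x * (u * g u)) * (y * Real.exp (-(u ^ 2 + x ^ 2) * y ^ 2)) ∂μ := by
          refine integral_congr_ae (.of_forall fun y => ?_)
          simp only [hFdef]
          rw [neg_add, add_mul, Real.exp_add]
          ring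
      _ = 1 / 2 * (x * f x) * (u * g u / (u ^ 2 + x ^ 2)) := by
          rw [integral_const_mul, integral_Ioi_mul_exp_neg_mul_sq hpos]
          field_simp
  rw [← hleft, hright]
end

section
/- Let 0 < μ < ν and let g : (0,∞) → ℝ be measurable such that u ↦ u^(2μ−2ν+1)·|g(u)| is integrable on (0,∞). Then ∫₀^∞ y^(2ν−2μ−1)·L₂{g}(y) dy = (Γ(ν)/Γ(μ))·∫₀^∞ x^(2μ−1)·P_{ν,2}{g}(x) dx. -/
open MeasureTheory Real Set

/-- Fubini for a nonnegative kernel `K` with marginal `w`, against a function `g` such that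
`w * |g|` is integrable. -/
lemma integral_integral_kernel_mul {α β : Type*} [MeasurableSpace α] [MeasurableSpace β]
    {ρ : Measure α} {σ : Measure β} [SFinite ρ] [SFinite σ] {K : α → β → ℝ} {w g : β → ℝ}
    (hK : Measurable (Function.uncurry K)) (hK_nonneg : ∀ᵐ u ∂σ, ∀ᵐ y ∂ρ, 0 ≤ K y u)
    (hK_int : ∀ᵐ u ∂σ, Integrable (fun y => K y u) ρ) (hw : ∀ᵐ u ∂σ, ∫ y, K y u ∂ρ = w u)
    (hg : AEMeasurable g σ) (hint : Integrable (fun u => w u * |g u|) σ) :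
    ∫ y, ∫ u, K y u * g u ∂σ ∂ρ = ∫ u, w u * g u ∂σ := by
  have hmeas : AEStronglyMeasurable (Function.uncurry fun y u => K y u * g u) (ρ.prod σ) :=
    (hK.aemeasurable.mul (hg.comp_snd (μ := ρ))).aestronglyMeasurable
  have hprod : Integrable (Function.uncurry fun y u => K y u * g u) (ρ.prod σ) := by
    refine (integrable_prod_iff' hmeas).2 ⟨?_, hint.congr ?_⟩
    · filter_upwards [hK_int] with u hu using hu.mul_const (g u)
    · filter_upwards [hK_nonneg, hw] with u hu hwu
      rw [← hwu, ← integral_mul_const]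
      refine integral_congr_ae ?_
      filter_upwards [hu] with y hy
      simp [abs_of_nonneg hy]
  rw [integral_integral_swap hprod]
  refine integral_congr_ae ?_
  filter_upwards [hw] with u hu
  rw [integral_mul_const, hu]

/-- The Mellin transform of the Gaussian `x ↦ exp (-t * x ^ 2)` at `2 * a`. -/
lemma integral_rpow_mul_exp_neg_mul_sq_s8 {a t : ℝ} (ha : 0 < a) (ht : 0 < t) :
    ∫ x in Ioi (0 : ℝ), x ^ (2 * a - 1) * Real.exp (-t * x ^ 2) =
      Real.Gamma a / 2 * t ^ (-a) := by
  have h := integral_rpow_mul_exp_neg_mul_rpow (p := 2) (q := 2 * a - 1) (b := t)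
    two_pos (by linarith) ht
  simp only [rpow_two] at h
  rw [h]
  ring_nf

/-- The second Euler integral in the form `∫ t ^ (s - 1) * exp (-t * b) = Γ(s) * b ^ (-s)`. -/
lemma integral_rpow_mul_exp_neg_mul {s b : ℝ} (hs : 0 < s) (hb : 0 < b) :
    ∫ t in Ioi (0 : ℝ), t ^ (s - 1) * Real.exp (-t * b) = Real.Gamma s * b ^ (-s) := by
  have h := Real.integral_rpow_mul_exp_neg_mul_Ioi hs hb
  rw [one_div, inv_rpow hb.le, ← rpow_neg hb.le] at h
  rw [mul_comm, ← h]
  simp only [neg_mul, mul_comm b]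

/-- The Mellin transform of `x ↦ (b + x ^ 2) ^ (-ν)` at `2 * μ`. -/
lemma integral_rpow_mul_add_sq_rpow_neg {μ ν b : ℝ} (hμ : 0 < μ) (hμν : μ < ν) (hb : 0 < b) :
    ∫ x in Ioi (0 : ℝ), x ^ (2 * μ - 1) * (b + x ^ 2) ^ (-ν) =
      Real.Gamma μ * Real.Gamma (ν - μ) / (2 * Real.Gamma ν) * b ^ (μ - ν) := by
  have hν : 0 < ν := hμ.trans hμν
  have hΓ := (Real.Gamma_pos_of_pos hν).ne'
  have hΓ' := (Real.Gamma_pos_of_pos (sub_pos.2 hμν)).ne'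
  have hweight : ∀ t ∈ Ioi (0 : ℝ),
      Real.Gamma μ / 2 * t ^ (-μ) * (t ^ (ν - 1) * Real.exp (-t * b)) =
        Real.Gamma μ / 2 * (t ^ (ν - μ - 1) * Real.exp (-t * b)) := by
    intro t ht
    rw [show ν - μ - 1 = -μ + (ν - 1) by ring, rpow_add ht]
    ring
  have hgint : IntegrableOn (fun t : ℝ => t ^ (ν - μ - 1) * Real.exp (-t * b)) (Ioi 0) := by
    refine Integrable.of_integral_ne_zero ?_
    rw [integral_rpow_mul_exp_neg_mul (sub_pos.2 hμν) hb]
    positivity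
  have key := integral_integral_kernel_mul (ρ := volume.restrict (Ioi (0 : ℝ)))
    (σ := volume.restrict (Ioi (0 : ℝ)))
    (K := fun x t => x ^ (2 * μ - 1) * Real.exp (-t * x ^ 2))
    (w := fun t => Real.Gamma μ / 2 * t ^ (-μ))
    (g := fun t => t ^ (ν - 1) * Real.exp (-t * b))
    (by unfold Function.uncurry; fun_prop)
    (.of_forall fun t => ae_restrict_of_forall_mem measurableSet_Ioi fun x (hx : 0 < x) => by
      positivity)
    (ae_restrict_of_forall_mem measurableSet_Ioi fun t ht =>
      integrableOn_rpow_mul_exp_neg_mul_sq ht (by linarith))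
    (ae_restrict_of_forall_mem measurableSet_Ioi fun t ht =>
      integral_rpow_mul_exp_neg_mul_sq_s8 hμ ht)
    (by fun_prop)
    ((hgint.const_mul (Real.Gamma μ / 2)).congr
      (ae_restrict_of_forall_mem measurableSet_Ioi fun t (ht : 0 < t) => by
        have hnn : 0 ≤ t ^ (ν - 1) * Real.exp (-t * b) := by positivity
        simp only [abs_of_nonneg hnn, hweight t ht]))
  rw [setIntegral_congr_fun measurableSet_Ioi hweight, integral_const_mul,
    integral_rpow_mul_exp_neg_mul (sub_pos.2 hμν) hb, neg_sub] at key
  have hinner : ∀ x ∈ Ioi (0 : ℝ),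
      ∫ t in Ioi (0 : ℝ), x ^ (2 * μ - 1) * Real.exp (-t * x ^ 2) *
        (t ^ (ν - 1) * Real.exp (-t * b)) =
      Real.Gamma ν * (x ^ (2 * μ - 1) * (b + x ^ 2) ^ (-ν)) := by
    intro x hx
    rw [mul_left_comm, ← integral_rpow_mul_exp_neg_mul hν (by positivity : 0 < b + x ^ 2),
      ← integral_const_mul]
    refine integral_congr_ae (.of_forall fun t => ?_)
    simp only [mul_add, Real.exp_add]
    ring
  rw [setIntegral_congr_fun measurableSet_Ioi hinner, integral_const_mul] at key
  field_simp
  field_simp at key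
  linarith

/-- `x ↦ x ^ (2 * μ - 1) * (b + x ^ 2) ^ (-ν)` is integrable on `(0, ∞)` for `0 < μ < ν`. -/
lemma integrableOn_rpow_mul_add_sq_rpow_neg {μ ν b : ℝ} (hμ : 0 < μ) (hμν : μ < ν)
    (hb : 0 < b) :
    IntegrableOn (fun x : ℝ => x ^ (2 * μ - 1) * (b + x ^ 2) ^ (-ν)) (Ioi 0) := by
  refine Integrable.of_integral_ne_zero ?_
  rw [integral_rpow_mul_add_sq_rpow_neg hμ hμν hb]
  have := Real.Gamma_pos_of_pos hμ
  have := Real.Gamma_pos_of_pos (hμ.trans hμν)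
  have := Real.Gamma_pos_of_pos (sub_pos.2 hμν)
  positivity

lemma mul_sq_rpow_sub {u : ℝ} (hu : 0 < u) (μ ν : ℝ) :
    u * (u ^ 2) ^ (μ - ν) = u ^ (2 * μ - 2 * ν + 1) := by
  rw [← rpow_two, ← rpow_mul hu.le, rpow_add_one hu.ne', mul_sub, mul_comm]

/-- The moment of order `2 * ν - 2 * μ - 1` of the `L₂`-transform. -/
lemma integral_rpow_mul_L2 {μ ν : ℝ} (hμν : μ < ν) {g : ℝ → ℝ}
    (hg : AEMeasurable g (volume.restrict (Ioi 0)))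
    (hint : IntegrableOn (fun u : ℝ => u ^ (2 * μ - 2 * ν + 1) * |g u|) (Ioi 0)) :
    ∫ y in Ioi (0 : ℝ),
        y ^ (2 * ν - 2 * μ - 1) * ∫ u in Ioi (0 : ℝ), u * Real.exp (-(u ^ 2) * y ^ 2) * g u =
      Real.Gamma (ν - μ) / 2 * ∫ u in Ioi (0 : ℝ), u ^ (2 * μ - 2 * ν + 1) * g u := by
  have hd : 0 < ν - μ := sub_pos.2 hμν
  have hw : ∀ u ∈ Ioi (0 : ℝ),
      ∫ y in Ioi (0 : ℝ), u * (y ^ (2 * (ν - μ) - 1) * Real.exp (-(u ^ 2) * y ^ 2)) =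
        Real.Gamma (ν - μ) / 2 * u ^ (2 * μ - 2 * ν + 1) := by
    intro u (hu : 0 < u)
    rw [integral_const_mul, integral_rpow_mul_exp_neg_mul_sq_s8 hd (pow_pos hu 2), neg_sub,
      mul_left_comm, mul_sq_rpow_sub hu]
  have hKi : ∀ u ∈ Ioi (0 : ℝ), IntegrableOn
      (fun y : ℝ => u * (y ^ (2 * (ν - μ) - 1) * Real.exp (-(u ^ 2) * y ^ 2))) (Ioi 0) :=
    fun u (hu : 0 < u) => Integrable.const_mul
      (integrableOn_rpow_mul_exp_neg_mul_sq (pow_pos hu 2) (by linarith)) u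
  have hconst : Integrable
      (fun u : ℝ => Real.Gamma (ν - μ) / 2 * u ^ (2 * μ - 2 * ν + 1) * |g u|)
      (volume.restrict (Ioi 0)) := by
    simp only [mul_assoc]
    exact Integrable.const_mul hint _
  have key := integral_integral_kernel_mul (ρ := volume.restrict (Ioi (0 : ℝ)))
    (by unfold Function.uncurry; fun_prop)
    (ae_restrict_of_forall_mem measurableSet_Ioi fun u (hu : 0 < u) =>
      ae_restrict_of_forall_mem measurableSet_Ioi fun y (hy : 0 < y) => by positivity)
    (ae_restrict_of_forall_mem measurableSet_Ioi hKi)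
    (ae_restrict_of_forall_mem measurableSet_Ioi hw) hg hconst
  simp only [mul_assoc (Real.Gamma (ν - μ) / 2), integral_const_mul] at key
  rw [← key]
  refine integral_congr_ae (.of_forall fun y => ?_)
  simp only [← integral_const_mul]
  refine integral_congr_ae (.of_forall fun u => ?_)
  simp only [mul_sub]
  ring

/-- The moment of order `2 * μ - 1` of the `P_{ν,2}`-transform. -/
lemma integral_rpow_mul_Pnu2 {μ ν : ℝ} (hμ : 0 < μ) (hμν : μ < ν) {g : ℝ → ℝ}
    (hg : AEMeasurable g (volume.restrict (Ioi 0)))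
    (hint : IntegrableOn (fun u : ℝ => u ^ (2 * μ - 2 * ν + 1) * |g u|) (Ioi 0)) :
    ∫ x in Ioi (0 : ℝ),
        x ^ (2 * μ - 1) * ∫ u in Ioi (0 : ℝ), u * g u / (u ^ 2 + x ^ 2) ^ ν =
      Real.Gamma μ * Real.Gamma (ν - μ) / (2 * Real.Gamma ν) *
        ∫ u in Ioi (0 : ℝ), u ^ (2 * μ - 2 * ν + 1) * g u := by
  set c := Real.Gamma μ * Real.Gamma (ν - μ) / (2 * Real.Gamma ν)
  have hw : ∀ u ∈ Ioi (0 : ℝ),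
      ∫ x in Ioi (0 : ℝ), u * (x ^ (2 * μ - 1) * (u ^ 2 + x ^ 2) ^ (-ν)) =
        c * u ^ (2 * μ - 2 * ν + 1) := by
    intro u (hu : 0 < u)
    rw [integral_const_mul, integral_rpow_mul_add_sq_rpow_neg hμ hμν (pow_pos hu 2),
      mul_left_comm, mul_sq_rpow_sub hu]
  have hKi : ∀ u ∈ Ioi (0 : ℝ), IntegrableOn
      (fun x : ℝ => u * (x ^ (2 * μ - 1) * (u ^ 2 + x ^ 2) ^ (-ν))) (Ioi 0) :=
    fun u (hu : 0 < u) => Integrable.const_mul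
      (integrableOn_rpow_mul_add_sq_rpow_neg hμ hμν (pow_pos hu 2)) u
  have hconst : Integrable (fun u : ℝ => c * u ^ (2 * μ - 2 * ν + 1) * |g u|)
      (volume.restrict (Ioi 0)) := by
    simp only [mul_assoc]
    exact Integrable.const_mul hint _
  have key := integral_integral_kernel_mul (ρ := volume.restrict (Ioi (0 : ℝ)))
    (by unfold Function.uncurry; fun_prop)
    (ae_restrict_of_forall_mem measurableSet_Ioi fun u (hu : 0 < u) =>
      ae_restrict_of_forall_mem measurableSet_Ioi fun y (hy : 0 < y) => by positivity)
    (ae_restrict_of_forall_mem measurableSet_Ioi hKi)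
    (ae_restrict_of_forall_mem measurableSet_Ioi hw) hg hconst
  simp only [mul_assoc c, integral_const_mul] at key
  rw [← key]
  refine integral_congr_ae (.of_forall fun x => ?_)
  simp only [← integral_const_mul]
  refine integral_congr_ae (.of_forall fun u => ?_)
  have hnn : 0 ≤ u ^ 2 + x ^ 2 := by positivity
  simp only [rpow_neg hnn]
  ring

/-- `∫₀^∞ y^(2ν-2μ-1) L₂{g}(y) dy = (Γ(ν)/Γ(μ)) ∫₀^∞ x^(2μ-1) P_{ν,2}{g}(x) dx`. -/
theorem moment_L2_eq_moment_Pnu2 (μ ν : ℝ) (hμ : 0 < μ) (hμν : μ < ν) (g : ℝ → ℝ)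
    (hg : AEMeasurable g (volume.restrict (Ioi 0)))
    (hint : IntegrableOn (fun u : ℝ => u ^ (2 * μ - 2 * ν + 1) * |g u|) (Ioi 0)) :
    ∫ y in Ioi (0 : ℝ),
        y ^ (2 * ν - 2 * μ - 1) *
          ∫ u in Ioi (0 : ℝ), u * Real.exp (-(u ^ 2) * y ^ 2) * g u
      = Real.Gamma ν / Real.Gamma μ *
          ∫ x in Ioi (0 : ℝ),
            x ^ (2 * μ - 1) * ∫ u in Ioi (0 : ℝ), u * g u / (u ^ 2 + x ^ 2) ^ ν := by
  have hΓμ := (Real.Gamma_pos_of_pos hμ).ne'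
  have hΓν := (Real.Gamma_pos_of_pos (hμ.trans hμν)).ne'
  rw [integral_rpow_mul_L2 hμν hg hint, integral_rpow_mul_Pnu2 hμ hμν hg hint]
  field_simp
end

section
/- Let 0 < μ < ν and let g : (0,∞) → ℝ be measurable such that u ↦ u^(2μ−2ν+1)·|g(u)| is integrable on (0,∞). Then ∫₀^∞ y^(2ν−2μ−1)·L₂{g}(y) dy = (Γ(ν−μ)/2)·∫₀^∞ u^(2μ−2ν+1)·g(u) du. -/
open MeasureTheory Real Set

lemma integral_rpow_mul_gaussian_mul_const {μ ν u : ℝ} (hμν : μ < ν) (hu : 0 < u) (c : ℝ) :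
    ∫ y in Ioi (0 : ℝ), y ^ (2 * ν - 2 * μ - 1) * (u * Real.exp (-(u ^ 2) * y ^ 2) * c)
      = Real.Gamma (ν - μ) / 2 * (u ^ (2 * μ - 2 * ν + 1) * c) := by
  have key := integral_rpow_mul_exp_neg_mul_rpow (p := 2) (q := 2 * ν - 2 * μ - 1) (b := u ^ 2)
    two_pos (by linarith) (by positivity)
  simp_rw [rpow_two] at key
  calc
    _ = ∫ y in Ioi (0 : ℝ),
          (u * c) * (y ^ (2 * ν - 2 * μ - 1) * Real.exp (-(u ^ 2) * y ^ 2)) := by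
      congr 1; ext y; ring
    _ = _ := by
      rw [integral_const_mul, key, ← rpow_natCast, ← rpow_mul hu.le, rpow_add_one hu.ne']
      rw [show ((2 : ℕ) : ℝ) * (-(2 * ν - 2 * μ - 1 + 1) / 2) = 2 * μ - 2 * ν by push_cast; ring,
        show (2 * ν - 2 * μ - 1 + 1) / 2 = ν - μ by ring]
      ring

lemma integrable_rpow_mul_gaussian_mul {μ ν : ℝ} (hμν : μ < ν) {g : ℝ → ℝ}
    (hg : AEMeasurable g (volume.restrict (Ioi 0)))
    (hint : IntegrableOn (fun u : ℝ => u ^ (2 * μ - 2 * ν + 1) * |g u|) (Ioi 0)) :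
    Integrable (Function.uncurry fun y u : ℝ =>
        y ^ (2 * ν - 2 * μ - 1) * (u * Real.exp (-(u ^ 2) * y ^ 2) * g u))
      ((volume.restrict (Ioi 0)).prod (volume.restrict (Ioi 0))) := by
  have hmeas : AEStronglyMeasurable (Function.uncurry fun y u : ℝ =>
        y ^ (2 * ν - 2 * μ - 1) * (u * Real.exp (-(u ^ 2) * y ^ 2) * g u))
      ((volume.restrict (Ioi 0)).prod (volume.restrict (Ioi 0))) := by
    have hsnd : AEMeasurable (fun z : ℝ × ℝ => g z.2)
        ((volume.restrict (Ioi (0 : ℝ))).prod (volume.restrict (Ioi 0))) := hg.comp_snd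
    have hpow : Measurable fun z : ℝ × ℝ => z.1 ^ (2 * ν - 2 * μ - 1) := by fun_prop
    have hker : Measurable fun z : ℝ × ℝ => z.2 * Real.exp (-(z.2 ^ 2) * z.1 ^ 2) := by fun_prop
    exact (hpow.aemeasurable.mul (hker.aemeasurable.mul hsnd)).aestronglyMeasurable
  refine (integrable_prod_iff' hmeas).2 ⟨?_, ?_⟩
  · filter_upwards [ae_restrict_mem measurableSet_Ioi] with u hu
    have hu : 0 < u := hu
    have h := (integrableOn_rpow_mul_exp_neg_mul_sq (b := u ^ 2) (by positivity)
      (s := 2 * ν - 2 * μ - 1) (by linarith)).const_mul (u * g u)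
    refine h.congr (.of_forall fun y => ?_)
    simp only [Function.uncurry]
    ring
  · refine (hint.const_mul (Real.Gamma (ν - μ) / 2)).congr ?_
    filter_upwards [ae_restrict_mem measurableSet_Ioi] with u hu
    have hu : 0 < u := hu
    rw [← integral_rpow_mul_gaussian_mul_const hμν hu]
    refine setIntegral_congr_fun measurableSet_Ioi fun y hy => ?_
    have hy : 0 < y := hy
    simp only [Function.uncurry, norm_mul, Real.norm_eq_abs, abs_exp, abs_of_pos hu,
      abs_of_pos (rpow_pos_of_pos hy _)]

/-- `∫₀^∞ y^(2ν-2μ-1) L₂{g}(y) dy = (Γ(ν-μ)/2) ∫₀^∞ u^(2μ-2ν+1) g(u) du`. -/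
theorem moment_L2_eq_moment_g (μ ν : ℝ) (hμ : 0 < μ) (hμν : μ < ν) (g : ℝ → ℝ)
    (hg : AEMeasurable g (volume.restrict (Ioi 0)))
    (hint : IntegrableOn (fun u : ℝ => u ^ (2 * μ - 2 * ν + 1) * |g u|) (Ioi 0)) :
    ∫ y in Ioi (0 : ℝ),
        y ^ (2 * ν - 2 * μ - 1) *
          ∫ u in Ioi (0 : ℝ), u * Real.exp (-(u ^ 2) * y ^ 2) * g u
      = Real.Gamma (ν - μ) / 2 *
          ∫ u in Ioi (0 : ℝ), u ^ (2 * μ - 2 * ν + 1) * g u := by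
  simp_rw [← integral_const_mul]
  rw [integral_integral_swap (integrable_rpow_mul_gaussian_mul hμν hg hint)]
  exact setIntegral_congr_fun measurableSet_Ioi fun u hu =>
    integral_rpow_mul_gaussian_mul_const hμν hu (g u)
end

section
/- Let 0 < μ < ν and let g : (0,∞) → ℝ be measurable such that u ↦ u^(2μ−2ν+1)·|g(u)| is integrable on (0,∞). Then ∫₀^∞ x^(2μ−1)·P_{ν,2}{g}(x) dx = (1/2)·B(μ, ν−μ)·∫₀^∞ u^(2μ−2ν+1)·g(u) du. -/
open MeasureTheory Real Set

/-- The real Beta integral over `(0, 1)`. -/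
lemma integral_Ioo_rpow_mul_one_sub_rpow {a b : ℝ} (ha : 0 < a) (hb : 0 < b) :
    ∫ t in Ioo (0 : ℝ) 1, t ^ (a - 1) * (1 - t) ^ (b - 1) = ProbabilityTheory.beta a b := by
  rw [ProbabilityTheory.beta_eq_betaIntegralReal a b ha hb, Complex.betaIntegral,
    intervalIntegral.integral_of_le zero_le_one, ← integral_Ioc_eq_integral_Ioo,
    ← RCLike.re_to_complex, ← integral_re]
  · refine setIntegral_congr_fun measurableSet_Ioc fun x ⟨hx₀, hx₁⟩ ↦ ?_
    norm_cast
    rw [← Complex.ofReal_cpow hx₀.le, ← Complex.ofReal_cpow (by linarith), RCLike.re_to_complex,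
      Complex.re_mul_ofReal, Complex.ofReal_re]
  · have h := Complex.betaIntegral_convergent (u := a) (v := b) (by simpa) (by simpa)
    rwa [intervalIntegrable_iff_integrableOn_Ioc_of_le zero_le_one] at h

lemma injOn_sq_div_sq_add_sq {u : ℝ} (hu : 0 < u) :
    InjOn (fun x : ℝ => x ^ 2 / (u ^ 2 + x ^ 2)) (Ioi 0) := by
  intro x hx y hy h
  have hx' : 0 < x := hx
  have hy' : 0 < y := hy
  simp only at h
  rw [div_eq_div_iff (by positivity) (by positivity)] at h
  have h' : u ^ 2 * x ^ 2 = u ^ 2 * y ^ 2 := by linarith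
  exact (pow_left_inj₀ hx'.le hy'.le two_ne_zero).1 (mul_left_cancel₀ (by positivity) h')

lemma image_sq_div_sq_add_sq {u : ℝ} (hu : 0 < u) :
    (fun x : ℝ => x ^ 2 / (u ^ 2 + x ^ 2)) '' Ioi 0 = Ioo 0 1 := by
  ext t
  constructor
  · rintro ⟨x, hx, rfl⟩
    have hx' : 0 < x := hx
    refine ⟨by positivity, ?_⟩
    rw [div_lt_one (by positivity)]
    nlinarith [pow_pos hu 2]
  · rintro ⟨ht₀, ht₁⟩
    have h1t : 0 < 1 - t := sub_pos.2 ht₁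
    refine ⟨u * √(t / (1 - t)), mem_Ioi.2 (by positivity), ?_⟩
    simp only [mul_pow, Real.sq_sqrt (div_pos ht₀ h1t).le]
    field_simp
    ring

lemma hasDerivAt_sq_div_sq_add_sq {u : ℝ} (hu : 0 < u) (x : ℝ) :
    HasDerivAt (fun x : ℝ => x ^ 2 / (u ^ 2 + x ^ 2)) (2 * x * u ^ 2 / (u ^ 2 + x ^ 2) ^ 2) x := by
  have h := (hasDerivAt_pow 2 x).fun_div ((hasDerivAt_pow 2 x).const_add (u ^ 2))
    (by positivity : u ^ 2 + x ^ 2 ≠ 0)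
  refine h.congr_deriv ?_
  push_cast
  ring

/-- The Mellin transform of `x ↦ (u² + x²)^(-ν)`, evaluated at `2μ`. -/
lemma integral_Ioi_rpow_div_sq_add_sq_rpow {μ ν u : ℝ} (hμ : 0 < μ) (hμν : μ < ν) (hu : 0 < u) :
    ∫ x in Ioi (0 : ℝ), x ^ (2 * μ - 1) / (u ^ 2 + x ^ 2) ^ ν
      = 1 / 2 * ProbabilityTheory.beta μ (ν - μ) * u ^ (2 * μ - 2 * ν) := by
  have h := integral_image_eq_integral_abs_deriv_smul measurableSet_Ioi
    (fun x _ => (hasDerivAt_sq_div_sq_add_sq hu x).hasDerivWithinAt) (injOn_sq_div_sq_add_sq hu)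
    (fun t : ℝ => t ^ (μ - 1) * (1 - t) ^ (ν - μ - 1))
  rw [image_sq_div_sq_add_sq hu, integral_Ioo_rpow_mul_one_sub_rpow hμ (sub_pos.2 hμν)] at h
  have hcongr : ∀ x ∈ Ioi (0 : ℝ),
      |2 * x * u ^ 2 / (u ^ 2 + x ^ 2) ^ 2| • ((x ^ 2 / (u ^ 2 + x ^ 2)) ^ (μ - 1) *
        (1 - x ^ 2 / (u ^ 2 + x ^ 2)) ^ (ν - μ - 1))
      = 2 * u ^ (2 * ν - 2 * μ) * (x ^ (2 * μ - 1) / (u ^ 2 + x ^ 2) ^ ν) := by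
    intro x hx
    have hx' : 0 < x := hx
    have hs : 0 < u ^ 2 + x ^ 2 := by positivity
    have h1 : 1 - x ^ 2 / (u ^ 2 + x ^ 2) = u ^ 2 / (u ^ 2 + x ^ 2) := by
      field_simp
      ring
    have hxp : x * (x ^ 2) ^ (μ - 1) = x ^ (2 * μ - 1) := by
      rw [← rpow_natCast_mul hx'.le, mul_comm, ← rpow_add_one hx'.ne']
      congr 1
      push_cast
      ring
    have hup : u ^ 2 * (u ^ 2) ^ (ν - μ - 1) = u ^ (2 * ν - 2 * μ) := by
      rw [← rpow_natCast_mul hu.le, ← rpow_natCast u 2, ← rpow_add hu]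
      congr 1
      push_cast
      ring
    have hsp : (u ^ 2 + x ^ 2) ^ ν = (u ^ 2 + x ^ 2) ^ 2 * (u ^ 2 + x ^ 2) ^ (μ - 1) *
        (u ^ 2 + x ^ 2) ^ (ν - μ - 1) := by
      rw [← rpow_natCast (u ^ 2 + x ^ 2) 2, ← rpow_add hs, ← rpow_add hs]
      congr 1
      push_cast
      ring
    rw [h1, div_rpow (by positivity) hs.le, div_rpow (by positivity) hs.le,
      abs_of_pos (by positivity), smul_eq_mul, hsp, ← hxp, ← hup]
    field_simp
  rw [setIntegral_congr_fun measurableSet_Ioi hcongr, integral_const_mul] at h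
  have hu' : u ^ (2 * ν - 2 * μ) * u ^ (2 * μ - 2 * ν) = 1 := by
    rw [← rpow_add hu]
    simp
  rw [h]
  linear_combination (-∫ x in Ioi (0 : ℝ), x ^ (2 * μ - 1) / (u ^ 2 + x ^ 2) ^ ν) * hu'

lemma integrableOn_Ioi_rpow_div_sq_add_sq_rpow {μ ν u : ℝ} (hμ : 0 < μ) (hμν : μ < ν)
    (hu : 0 < u) :
    IntegrableOn (fun x : ℝ => x ^ (2 * μ - 1) / (u ^ 2 + x ^ 2) ^ ν) (Ioi 0) := by
  refine Integrable.of_integral_ne_zero ?_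
  rw [integral_Ioi_rpow_div_sq_add_sq_rpow hμ hμν hu]
  have := ProbabilityTheory.beta_pos hμ (sub_pos.2 hμν)
  positivity

lemma integral_Ioi_rpow_mul_kernel {μ ν u : ℝ} (hμ : 0 < μ) (hμν : μ < ν) (hu : 0 < u) (c : ℝ) :
    ∫ x in Ioi (0 : ℝ), x ^ (2 * μ - 1) * (u * c / (u ^ 2 + x ^ 2) ^ ν)
      = 1 / 2 * ProbabilityTheory.beta μ (ν - μ) * (u ^ (2 * μ - 2 * ν + 1) * c) := by
  have h : ∀ x : ℝ, x ^ (2 * μ - 1) * (u * c / (u ^ 2 + x ^ 2) ^ ν)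
      = u * c * (x ^ (2 * μ - 1) / (u ^ 2 + x ^ 2) ^ ν) := fun x => by ring
  simp_rw [h]
  rw [integral_const_mul, integral_Ioi_rpow_div_sq_add_sq_rpow hμ hμν hu, rpow_add_one hu.ne']
  ring

lemma integrable_prod_rpow_mul_kernel {μ ν : ℝ} (hμ : 0 < μ) (hμν : μ < ν) {g : ℝ → ℝ}
    (hg : AEMeasurable g (volume.restrict (Ioi 0)))
    (hint : IntegrableOn (fun u : ℝ => u ^ (2 * μ - 2 * ν + 1) * |g u|) (Ioi 0)) :
    Integrable
      (Function.uncurry fun x u : ℝ => x ^ (2 * μ - 1) * (u * g u / (u ^ 2 + x ^ 2) ^ ν))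
      ((volume.restrict (Ioi 0)).prod (volume.restrict (Ioi 0))) := by
  have hmeas : AEStronglyMeasurable
      (Function.uncurry fun x u : ℝ => x ^ (2 * μ - 1) * (u * g u / (u ^ 2 + x ^ 2) ^ ν))
      ((volume.restrict (Ioi 0)).prod (volume.restrict (Ioi 0))) := by
    have hg' : AEMeasurable (fun p : ℝ × ℝ => g p.2)
        ((volume.restrict (Ioi 0)).prod (volume.restrict (Ioi 0))) := hg.comp_snd
    refine AEMeasurable.aestronglyMeasurable ?_
    unfold Function.uncurry
    fun_prop
  rw [integrable_prod_iff' hmeas]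
  constructor
  · filter_upwards [ae_restrict_mem measurableSet_Ioi] with u hu
    refine ((integrableOn_Ioi_rpow_div_sq_add_sq_rpow hμ hμν hu).const_mul (u * g u)).congr
      (.of_forall fun x => ?_)
    simp only [Function.uncurry_apply_pair]
    ring
  · refine (hint.const_mul (1 / 2 * ProbabilityTheory.beta μ (ν - μ))).congr ?_
    filter_upwards [ae_restrict_mem measurableSet_Ioi] with u hu
    rw [← integral_Ioi_rpow_mul_kernel hμ hμν hu]
    refine setIntegral_congr_fun measurableSet_Ioi fun x hx => ?_
    have hx' : 0 < x := hx
    have hu' : 0 < u := hu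
    simp only [Function.uncurry_apply_pair, norm_mul, norm_div, Real.norm_eq_abs]
    rw [abs_of_pos hu', abs_of_pos (rpow_pos_of_pos hx' _),
      abs_of_pos (rpow_pos_of_pos (by positivity : 0 < u ^ 2 + x ^ 2) _)]

/-- `∫₀^∞ x^(2μ-1) P_{ν,2}{g}(x) dx = (1/2) B(μ, ν-μ) ∫₀^∞ u^(2μ-2ν+1) g(u) du`,
where `B(a,b) = Γ(a)Γ(b)/Γ(a+b)` is the Beta function. -/
theorem moment_Pnu2_eq_beta_moment (μ ν : ℝ) (hμ : 0 < μ) (hμν : μ < ν) (g : ℝ → ℝ)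
    (hg : AEMeasurable g (volume.restrict (Ioi 0)))
    (hint : IntegrableOn (fun u : ℝ => u ^ (2 * μ - 2 * ν + 1) * |g u|) (Ioi 0)) :
    ∫ x in Ioi (0 : ℝ),
        x ^ (2 * μ - 1) * ∫ u in Ioi (0 : ℝ), u * g u / (u ^ 2 + x ^ 2) ^ ν
      = (1 / 2) * (Real.Gamma μ * Real.Gamma (ν - μ) / Real.Gamma (μ + (ν - μ))) *
          ∫ u in Ioi (0 : ℝ), u ^ (2 * μ - 2 * ν + 1) * g u := by
  simp_rw [← integral_const_mul (_ ^ (2 * μ - 1))]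
  rw [integral_integral_swap (integrable_prod_rpow_mul_kernel hμ hμν hg hint),
    setIntegral_congr_fun measurableSet_Ioi
      fun u hu => integral_Ioi_rpow_mul_kernel hμ hμν hu (g u), integral_const_mul,
    ProbabilityTheory.beta]
end

section
/- Let a be a real number and let y > 0. Then the L₂-transform of x ↦ cos(a·x)/x at y satisfies ∫₀^∞ exp(−x²y²)·cos(a·x) dx = (√π/(2y))·exp(−a²/(4y²)); equivalently, L₂{x ↦ cos(a·x)/x}(1/(2y)) = √π·y·exp(−a²y²). -/
open MeasureTheory Real Set

/-- The real part of the Fourier integral of a Gaussian over the whole line. -/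
theorem integral_exp_neg_mul_sq_mul_cos {b : ℝ} (hb : 0 < b) (a : ℝ) :
    ∫ x : ℝ, Real.exp (-b * x ^ 2) * Real.cos (a * x)
      = Real.sqrt (π / b) * Real.exp (-a ^ 2 / (4 * b)) := by
  have hb' : 0 < (b : ℂ).re := by simpa using hb
  have hint : Integrable fun x : ℝ ↦
      Complex.exp (Complex.I * a * x) * Complex.exp (-b * x ^ 2) := by
    refine (integrable_cexp_quadratic hb' (Complex.I * a) 0).congr (.of_forall fun x ↦ ?_)
    simp only [← Complex.exp_add]
    ring_nf
  have hre (x : ℝ) : (Complex.exp (Complex.I * a * x) * Complex.exp (-b * x ^ 2)).re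
      = Real.exp (-b * x ^ 2) * Real.cos (a * x) := by
    have h₁ : Complex.exp (-b * x ^ 2) = (Real.exp (-b * x ^ 2) : ℂ) := by push_cast; rfl
    have h₂ : Complex.I * a * x = ((a * x : ℝ) : ℂ) * Complex.I := by push_cast; ring
    rw [h₁, h₂, Complex.re_mul_ofReal, Complex.exp_ofReal_mul_I_re, mul_comm]
  have hval : ((π : ℂ) / b) ^ (1 / 2 : ℂ) * Complex.exp (-(a : ℂ) ^ 2 / (4 * b))
      = ((Real.sqrt (π / b) * Real.exp (-a ^ 2 / (4 * b)) : ℝ) : ℂ) := by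
    rw [Real.sqrt_eq_rpow, Complex.ofReal_mul, Complex.ofReal_cpow (by positivity)]
    push_cast
    rfl
  have key := congrArg Complex.re (fourierIntegral_gaussian hb' a)
  rw [hval, Complex.ofReal_re, ← RCLike.re_eq_complex_re, ← integral_re hint] at key
  simpa only [RCLike.re_eq_complex_re, hre] using key

/-- The `L₂`-transform of `x ↦ cos(a x)/x` at `y`:
`∫₀^∞ exp(-x²y²) cos(a x) dx = (√π/(2y)) exp(-a²/(4y²))`. -/
theorem L2_cos_div_x (a y : ℝ) (hy : 0 < y) :
    ∫ x in Ioi (0 : ℝ), Real.exp (-(x ^ 2) * y ^ 2) * Real.cos (a * x)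
      = Real.sqrt π / (2 * y) * Real.exp (-(a ^ 2) / (4 * y ^ 2)) := by
  have heven (x : ℝ) : Real.exp (-(|x| ^ 2) * y ^ 2) * Real.cos (a * |x|)
      = Real.exp (-y ^ 2 * x ^ 2) * Real.cos (a * x) := by
    have hcos : Real.cos (a * |x|) = Real.cos (a * x) := by
      rcases abs_choice x with h | h <;> simp [h]
    rw [hcos, sq_abs]
    ring_nf
  have h := integral_comp_abs (f := fun x ↦ Real.exp (-(x ^ 2) * y ^ 2) * Real.cos (a * x))
  simp only [heven] at h
  rw [integral_exp_neg_mul_sq_mul_cos (pow_pos hy 2), Real.sqrt_div pi_pos.le,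
    Real.sqrt_sq hy.le] at h
  rw [← mul_right_inj' (two_ne_zero' ℝ), ← h]
  field_simp
end

section
/- Let a ≥ 0 and y > 0. Then ∫₀^∞ cos(a·x)/(x²+y²) dx = (π/(2y))·exp(−a·y); equivalently, the Widder potential transform of x ↦ cos(a·x)/x at y equals (π/(2y))·exp(−a·y). -/
open MeasureTheory Real Set

open scoped FourierTransform

/-- Integrability of the two-sided exponential `t ↦ exp(i s t) exp(-c |t|)` and its integral. -/
lemma integrable_and_integral_cexp_mul_cexp_neg_abs {c : ℝ} (hc : 0 < c) (s : ℝ) :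
    Integrable (fun t : ℝ ↦
        Complex.exp (↑(s * t) * Complex.I) * Complex.exp (-(c * |t| : ℝ))) ∧
      ∫ t : ℝ, Complex.exp (↑(s * t) * Complex.I) * Complex.exp (-(c * |t| : ℝ))
        = ((2 * c / (c ^ 2 + s ^ 2) : ℝ) : ℂ) := by
  have hneg : EqOn (fun t : ℝ ↦ Complex.exp ((c + s * Complex.I) * t))
      (fun t : ℝ ↦ Complex.exp (↑(s * t) * Complex.I) * Complex.exp (-(c * |t| : ℝ)))
      (Iic 0) := by
    intro t ht
    simp only [← Complex.exp_add, abs_of_nonpos (mem_Iic.1 ht)]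
    push_cast
    ring_nf
  have hpos : EqOn (fun t : ℝ ↦ Complex.exp ((-c + s * Complex.I) * t))
      (fun t : ℝ ↦ Complex.exp (↑(s * t) * Complex.I) * Complex.exp (-(c * |t| : ℝ)))
      (Ioi 0) := by
    intro t ht
    simp only [← Complex.exp_add, abs_of_pos (mem_Ioi.1 ht)]
    push_cast
    ring_nf
  have hre_neg : 0 < ((c : ℂ) + s * Complex.I).re := by simpa using hc
  have hre_pos : (-(c : ℂ) + s * Complex.I).re < 0 := by simpa using hc
  have hint_neg := (integrableOn_exp_mul_complex_Iic hre_neg 0).congr_fun hneg measurableSet_Iic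
  have hint_pos := (integrableOn_exp_mul_complex_Ioi hre_pos 0).congr_fun hpos measurableSet_Ioi
  refine ⟨?_, ?_⟩
  · rw [← integrableOn_univ, ← Iic_union_Ioi (a := (0 : ℝ))]
    exact hint_neg.union hint_pos
  · rw [← intervalIntegral.integral_Iic_add_Ioi hint_neg hint_pos,
      ← setIntegral_congr_fun measurableSet_Iic hneg,
      ← setIntegral_congr_fun measurableSet_Ioi hpos,
      integral_exp_mul_complex_Iic hre_neg, integral_exp_mul_complex_Ioi hre_pos]
    have h₁ : (c : ℂ) + s * Complex.I ≠ 0 := fun h ↦ by simp [h] at hre_neg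
    have h₂ : -(c : ℂ) + s * Complex.I ≠ 0 := fun h ↦ by simp [h] at hre_pos
    have h₃ : (c : ℂ) ^ 2 + s ^ 2 ≠ 0 := by exact_mod_cast (by positivity : c ^ 2 + s ^ 2 ≠ 0)
    simp only [Complex.ofReal_zero, mul_zero, Complex.exp_zero]
    push_cast
    rw [div_add_div _ _ h₁ h₂, div_eq_div_iff (mul_ne_zero h₁ h₂) h₃]
    linear_combination (2 * (c : ℂ) * s ^ 2) * -Complex.I_sq

/-- The Fourier transform of `t ↦ exp(-2 π y |t|)` is the Poisson kernel. -/
lemma fourier_cexp_neg_abs {y : ℝ} (hy : 0 < y) (w : ℝ) :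
    𝓕 (fun t : ℝ ↦ Complex.exp (-(2 * π * y * |t| : ℝ))) w
      = ((y / π * (w ^ 2 + y ^ 2)⁻¹ : ℝ) : ℂ) := by
  have h := (integrable_and_integral_cexp_mul_cexp_neg_abs
    (show 0 < 2 * π * y by positivity) (-2 * π * w)).2
  have hkernel : y / π * (w ^ 2 + y ^ 2)⁻¹
      = 2 * (2 * π * y) / ((2 * π * y) ^ 2 + (-2 * π * w) ^ 2) := by
    field_simp
    ring
  rw [Real.fourier_eq', hkernel, ← h]
  refine integral_congr_ae (Filter.Eventually.of_forall fun t ↦ ?_)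
  simp only [smul_eq_mul, RCLike.inner_apply, conj_trivial]
  ring_nf

lemma integrable_inv_sq_add_sq {y : ℝ} (hy : 0 < y) :
    Integrable (fun x : ℝ ↦ (x ^ 2 + y ^ 2)⁻¹) := by
  have h := (integrable_inv_one_add_sq.comp_div hy.ne').const_mul (y ^ 2)⁻¹
  refine h.congr (Filter.Eventually.of_forall fun x ↦ ?_)
  simp only
  field_simp
  ring

/-- The Widder potential transform of `x ↦ cos(a x)/x` at `y`:
`∫₀^∞ cos(a x)/(x²+y²) dx = (π/(2y)) exp(-a y)`. -/
theorem widder_cos_div_x (a y : ℝ) (ha : 0 ≤ a) (hy : 0 < y) :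
    ∫ x in Ioi (0 : ℝ), Real.cos (a * x) / (x ^ 2 + y ^ 2)
      = π / (2 * y) * Real.exp (-(a * y)) := by
  have hf : Integrable (fun t : ℝ ↦ Complex.exp (-(2 * π * y * |t| : ℝ))) := by
    simpa using (integrable_and_integral_cexp_mul_cexp_neg_abs
      (show 0 < 2 * π * y by positivity) 0).1
  have hF : 𝓕 (fun t : ℝ ↦ Complex.exp (-(2 * π * y * |t| : ℝ)))
      = fun w : ℝ ↦ ((y / π * (w ^ 2 + y ^ 2)⁻¹ : ℝ) : ℂ) := funext (fourier_cexp_neg_abs hy)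
  have hFint : Integrable (fun w : ℝ ↦ ((y / π * (w ^ 2 + y ^ 2)⁻¹ : ℝ) : ℂ)) :=
    ((integrable_inv_sq_add_sq hy).const_mul _).ofReal
  have hinv := hf.fourierInv_fourier_eq (hF ▸ hFint) (v := a / (2 * π))
    (by fun_prop)
  rw [hF, Real.fourierInv_eq'] at hinv
  have hkernel : Integrable (fun w : ℝ ↦ Complex.exp (↑(2 * π * inner ℝ w (a / (2 * π))) *
      Complex.I) • ((y / π * (w ^ 2 + y ^ 2)⁻¹ : ℝ) : ℂ)) := by
    refine hFint.bdd_mul (c := 1) (by fun_prop) (Filter.Eventually.of_forall fun w ↦ ?_)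
    exact (Complex.norm_exp_ofReal_mul_I _).le
  have hre := congrArg Complex.re hinv
  rw [← RCLike.re_eq_complex_re, ← integral_re hkernel] at hre
  have hcos : ∀ w : ℝ, RCLike.re (Complex.exp (↑(2 * π * inner ℝ w (a / (2 * π))) *
      Complex.I) • ((y / π * (w ^ 2 + y ^ 2)⁻¹ : ℝ) : ℂ))
      = y / π * (Real.cos (a * |w|) / (|w| ^ 2 + y ^ 2)) := by
    intro w
    have harg : 2 * π * inner ℝ w (a / (2 * π)) = a * w := by
      simp only [RCLike.inner_apply, conj_trivial]
      field_simp
    have habs : Real.cos (a * |w|) = Real.cos (a * w) := by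
      rw [← Real.cos_abs (a * w), abs_mul, abs_of_nonneg ha]
    rw [harg, habs, sq_abs, smul_eq_mul, RCLike.re_eq_complex_re, Complex.re_mul_ofReal,
      Complex.exp_ofReal_mul_I_re]
    ring
  have hval : 2 * π * y * |a / (2 * π)| = a * y := by
    rw [abs_of_nonneg (by positivity)]
    field_simp
  simp only [hcos] at hre
  rw [integral_const_mul, integral_comp_abs (f := fun x ↦ Real.cos (a * x) / (x ^ 2 + y ^ 2)),
    hval, RCLike.re_eq_complex_re, ← Complex.ofReal_neg, Complex.exp_ofReal_re] at hre
  rw [← hre]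
  field_simp
end

section
/- Let z > 0 and let f : (0,∞) → ℝ be measurable and integrable on (0,∞). Then ∫₀^∞ cos(z·u)·P{f}(u) du = (π/2)·∫₀^∞ exp(−z·x)·f(x) dx; that is, the Fourier cosine transform of the Widder potential transform of f equals π/2 times the Laplace transform of f. -/
open MeasureTheory Real Set
open scoped FourierTransform

lemma integrable_div_sq_add_sq {x : ℝ} (hx : 0 < x) :
    Integrable fun u : ℝ => x / (x ^ 2 + u ^ 2) := by
  refine ((integrable_inv_one_add_sq.comp_div hx.ne').const_mul x⁻¹).congr
    (.of_forall fun u => ?_)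
  have : x ^ 2 + u ^ 2 ≠ 0 := by positivity
  dsimp only
  field_simp

lemma integrableOn_Ioi_exp_mul_exp_abs {x : ℝ} (hx : 0 < x) (c : ℝ) :
    IntegrableOn (fun t : ℝ => Complex.exp (↑(c * t) * Complex.I) * (exp (-(x * |t|)) : ℂ))
      (Ioi 0) := by
  refine (integrableOn_exp_mul_complex_Ioi (a := -x + c * Complex.I) (by simpa) 0).congr_fun
    (fun t ht => ?_) measurableSet_Ioi
  rw [abs_of_pos ht, Complex.ofReal_exp, ← Complex.exp_add]
  push_cast
  ring_nf

lemma integrableOn_Iic_exp_mul_exp_abs {x : ℝ} (hx : 0 < x) (c : ℝ) :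
    IntegrableOn (fun t : ℝ => Complex.exp (↑(c * t) * Complex.I) * (exp (-(x * |t|)) : ℂ))
      (Iic 0) := by
  refine (integrableOn_exp_mul_complex_Iic (a := x + c * Complex.I) (by simpa) 0).congr_fun
    (fun t ht => ?_) measurableSet_Iic
  rw [abs_of_nonpos ht, Complex.ofReal_exp, ← Complex.exp_add]
  push_cast
  ring_nf

lemma integral_exp_mul_exp_abs {x : ℝ} (hx : 0 < x) (c : ℝ) :
    ∫ t : ℝ, Complex.exp (↑(c * t) * Complex.I) * (exp (-(x * |t|)) : ℂ)
      = ((2 * (x / (x ^ 2 + c ^ 2)) : ℝ) : ℂ) := by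
  have hIic : ∫ t : ℝ in Iic 0, Complex.exp (↑(c * t) * Complex.I) * (exp (-(x * |t|)) : ℂ)
      = 1 / (x + c * Complex.I) := by
    rw [setIntegral_congr_fun (g := fun t : ℝ => Complex.exp ((x + c * Complex.I) * t))
      measurableSet_Iic, integral_exp_mul_complex_Iic (by simpa)]
    · simp
    · intro t ht
      dsimp only
      rw [abs_of_nonpos ht, Complex.ofReal_exp, ← Complex.exp_add]
      push_cast
      ring_nf
  have hIoi : ∫ t : ℝ in Ioi 0, Complex.exp (↑(c * t) * Complex.I) * (exp (-(x * |t|)) : ℂ)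
      = -1 / (-x + c * Complex.I) := by
    rw [setIntegral_congr_fun (g := fun t : ℝ => Complex.exp ((-x + c * Complex.I) * t))
      measurableSet_Ioi, integral_exp_mul_complex_Ioi (by simpa)]
    · simp
    · intro t ht
      dsimp only
      rw [abs_of_pos ht, Complex.ofReal_exp, ← Complex.exp_add]
      push_cast
      ring_nf
  rw [← intervalIntegral.integral_Iic_add_Ioi (integrableOn_Iic_exp_mul_exp_abs hx c)
    (integrableOn_Ioi_exp_mul_exp_abs hx c), hIic, hIoi]
  have h₁ : (x + c * Complex.I : ℂ) ≠ 0 := fun h => hx.ne' (by simpa using congrArg Complex.re h)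
  have h₂ : (-x + c * Complex.I : ℂ) ≠ 0 := fun h => hx.ne' (by simpa using congrArg Complex.re h)
  have h₃ : (x ^ 2 + c ^ 2 : ℂ) ≠ 0 := by
    exact_mod_cast (by positivity : x ^ 2 + c ^ 2 ≠ 0)
  push_cast
  field_simp
  ring_nf
  simp only [Complex.I_sq]
  ring

lemma fourier_exp_neg_mul_abs {x : ℝ} (hx : 0 < x) (w : ℝ) :
    𝓕 (fun t : ℝ => (exp (-(x * |t|)) : ℂ)) w
      = ((2 * (x / (x ^ 2 + (2 * π * w) ^ 2)) : ℝ) : ℂ) := by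
  rw [fourier_real_eq_integral_exp_smul, ← neg_sq (2 * π * w), ← integral_exp_mul_exp_abs hx]
  congr 1 with t
  rw [smul_eq_mul]
  ring_nf

lemma integral_cexp_mul_div_sq_add_sq {x : ℝ} (hx : 0 < x) (z : ℝ) :
    ∫ u : ℝ, Complex.exp (↑(z * u) * Complex.I) * ((x / (x ^ 2 + u ^ 2) : ℝ) : ℂ)
      = ((π * exp (-(x * |z|)) : ℝ) : ℂ) := by
  have hcont : Continuous fun t : ℝ => (exp (-(x * |t|)) : ℂ) := by fun_prop
  have hint : Integrable fun t : ℝ => (exp (-(x * |t|)) : ℂ) := by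
    rw [← integrableOn_univ, ← Iic_union_Ioi (a := (0 : ℝ))]
    simpa using! (integrableOn_Iic_exp_mul_exp_abs hx 0).union
      (integrableOn_Ioi_exp_mul_exp_abs hx 0)
  have hfourier : 𝓕 (fun t : ℝ => (exp (-(x * |t|)) : ℂ))
      = fun w => ((2 * (x / (x ^ 2 + (2 * π * w) ^ 2)) : ℝ) : ℂ) :=
    funext (fourier_exp_neg_mul_abs hx)
  have hint' : Integrable (𝓕 fun t : ℝ => (exp (-(x * |t|)) : ℂ)) := by
    rw [hfourier]
    exact (((integrable_div_sq_add_sq hx).comp_mul_left' two_pi_pos.ne').const_mul 2).ofReal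
  have hinv := congrFun (hcont.fourierInv_fourier_eq hint hint') z
  rw [hfourier, fourierInv_eq'] at hinv
  have hscale := Measure.integral_comp_mul_left (fun u : ℝ =>
    Complex.exp (↑(z * u) * Complex.I) * ((x / (x ^ 2 + u ^ 2) : ℝ) : ℂ)) (2 * π)
  have hleft : ∫ v : ℝ, Complex.exp (↑(2 * π * inner ℝ v z) * Complex.I) •
        ((2 * (x / (x ^ 2 + (2 * π * v) ^ 2)) : ℝ) : ℂ)
      = 2 * ∫ v : ℝ, Complex.exp (↑(z * (2 * π * v)) * Complex.I) *
        ((x / (x ^ 2 + (2 * π * v) ^ 2) : ℝ) : ℂ) := by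
    rw [← integral_const_mul]
    congr 1 with v
    simp only [RCLike.inner_apply, conj_trivial, smul_eq_mul]
    push_cast
    ring_nf
  rw [hleft, hscale, abs_of_pos (by positivity), Complex.real_smul] at hinv
  have hpi : (π : ℂ) ≠ 0 := by exact_mod_cast pi_ne_zero
  rw [Complex.ofReal_mul, ← hinv, Complex.ofReal_inv, Complex.ofReal_mul, Complex.ofReal_ofNat,
    ← mul_assoc, ← mul_assoc, show (π : ℂ) * 2 * (2 * (π : ℂ))⁻¹ = 1 by field_simp, one_mul]

/-- The Fourier cosine transform of the Poisson kernel. -/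
lemma integral_Ioi_cos_mul_div_sq_add_sq {x : ℝ} (hx : 0 < x) {z : ℝ} (hz : 0 ≤ z) :
    ∫ u in Ioi (0 : ℝ), cos (z * u) * (x / (x ^ 2 + u ^ 2)) = π / 2 * exp (-(z * x)) := by
  have hre : ∫ u : ℝ, cos (z * u) * (x / (x ^ 2 + u ^ 2)) = π * exp (-(z * x)) := by
    have h := congrArg Complex.re (integral_cexp_mul_div_sq_add_sq hx z)
    rw [Complex.ofReal_re, abs_of_nonneg hz, mul_comm x z] at h
    rw [← h, ← RCLike.re_eq_complex_re, ← integral_re]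
    · simp only [RCLike.re_eq_complex_re, Complex.re_mul_ofReal, Complex.exp_ofReal_mul_I_re]
    · refine (integrable_div_sq_add_sq hx).ofReal.bdd_mul (c := 1)
        (by fun_prop) (.of_forall fun u => ?_)
      rw [Complex.norm_exp_ofReal_mul_I]
  have heven := integral_comp_abs (f := fun u : ℝ => cos (z * u) * (x / (x ^ 2 + u ^ 2)))
  have habs (u : ℝ) : cos (z * |u|) = cos (z * u) := by
    rw [← cos_abs (z * u), abs_mul, abs_of_nonneg hz]
  simp only [sq_abs, habs] at heven
  linarith

lemma integrable_prod_cos_mul_div_sq_add_sq (z : ℝ) {f : ℝ → ℝ}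
    (hint : IntegrableOn f (Ioi 0)) :
    Integrable (Function.uncurry fun u x : ℝ => cos (z * u) * (x * f x / (x ^ 2 + u ^ 2)))
      ((volume.restrict (Ioi 0)).prod (volume.restrict (Ioi 0))) := by
  have hker : Integrable (fun p : ℝ × ℝ => f p.2 * (p.2 / (p.2 ^ 2 + p.1 ^ 2)))
      ((volume.restrict (Ioi 0)).prod (volume.restrict (Ioi 0))) := by
    rw [integrable_prod_iff']
    · constructor
      · filter_upwards [ae_restrict_mem measurableSet_Ioi] with x hx
        exact ((integrable_div_sq_add_sq hx).integrableOn).const_mul _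
      · refine (hint.norm.mul_const (π / 2)).congr ?_
        filter_upwards [ae_restrict_mem measurableSet_Ioi] with x hx
        have h := integral_Ioi_cos_mul_div_sq_add_sq hx le_rfl
        simp only [zero_mul, cos_zero, one_mul, neg_zero, exp_zero, mul_one] at h
        have hx' : 0 < x := hx
        have hnorm (u : ℝ) : ‖f x * (x / (x ^ 2 + u ^ 2))‖ = ‖f x‖ * (x / (x ^ 2 + u ^ 2)) := by
          rw [norm_mul, norm_of_nonneg (by positivity : 0 ≤ x / (x ^ 2 + u ^ 2))]
        simp only [hnorm, integral_const_mul, h]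
    · exact hint.aestronglyMeasurable.comp_snd.mul
        (by fun_prop : Measurable fun p : ℝ × ℝ =>
          p.2 / (p.2 ^ 2 + p.1 ^ 2)).aestronglyMeasurable
  refine (hker.bdd_mul (f := fun p : ℝ × ℝ => cos (z * p.1)) (c := 1) (by fun_prop)
    (.of_forall fun p => abs_cos_le_one _)).congr (.of_forall fun p => ?_)
  simp only [Function.uncurry]
  ring

/-- The Fourier cosine transform of the Widder potential transform of `f` equals
`π/2` times the Laplace transform of `f`:
`∫₀^∞ cos(z u) P{f}(u) du = (π/2) ∫₀^∞ exp(-z x) f(x) dx`. -/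
theorem cosine_widder_eq_laplace (z : ℝ) (hz : 0 < z) (f : ℝ → ℝ)
    (hf : AEMeasurable f (volume.restrict (Ioi 0)))
    (hint : IntegrableOn f (Ioi 0)) :
    ∫ u in Ioi (0 : ℝ),
        Real.cos (z * u) * ∫ x in Ioi (0 : ℝ), x * f x / (x ^ 2 + u ^ 2)
      = π / 2 * ∫ x in Ioi (0 : ℝ), Real.exp (-(z * x)) * f x := by
  simp only [← integral_const_mul]
  rw [integral_integral_swap (integrable_prod_cos_mul_div_sq_add_sq z hint)]
  refine setIntegral_congr_fun measurableSet_Ioi fun x hx => ?_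
  rw [← mul_assoc, ← integral_Ioi_cos_mul_div_sq_add_sq hx hz.le, ← integral_mul_const]
  congr 1 with u
  ring
end

section
/- Let f, g : (0,∞) → ℝ be measurable such that the function (x,y) ↦ |f(x)|·|g(y)|/√(x²+y²) is integrable on (0,∞) × (0,∞). Then the Parseval–Goldstein type identity ∫₀^∞ f(x)·G{g}(x) dx = ∫₀^∞ g(y)·G{f}(y) dy holds. -/
open MeasureTheory Real Set

/-- Glasser's Parseval–Goldstein type identity:
`∫₀^∞ f(x) G{g}(x) dx = ∫₀^∞ g(y) G{f}(y) dy`. -/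
theorem parseval_goldstein_glasser (f g : ℝ → ℝ)
    (hf : AEMeasurable f (volume.restrict (Ioi 0)))
    (hg : AEMeasurable g (volume.restrict (Ioi 0)))
    (hint : IntegrableOn
      (fun p : ℝ × ℝ => |f p.1| * |g p.2| / Real.sqrt (p.1 ^ 2 + p.2 ^ 2))
      (Ioi 0 ×ˢ Ioi 0)) :
    ∫ x in Ioi (0 : ℝ), f x * ∫ y in Ioi (0 : ℝ), g y / Real.sqrt (y ^ 2 + x ^ 2)
      = ∫ y in Ioi (0 : ℝ), g y * ∫ x in Ioi (0 : ℝ), f x / Real.sqrt (x ^ 2 + y ^ 2) := by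
  have hprod : Integrable
      (fun p : ℝ × ℝ => f p.1 * g p.2 / Real.sqrt (p.1 ^ 2 + p.2 ^ 2))
      ((volume.restrict (Ioi 0)).prod (volume.restrict (Ioi 0))) := by
    rw [IntegrableOn, Measure.volume_eq_prod, ← Measure.prod_restrict] at hint
    refine hint.mono' ?_ (.of_forall fun p => ?_)
    · have hsqrt : Measurable fun p : ℝ × ℝ => Real.sqrt (p.1 ^ 2 + p.2 ^ 2) := by fun_prop
      exact ((hf.comp_fst.mul hg.comp_snd).div hsqrt.aemeasurable).aestronglyMeasurable
    · simp [abs_of_nonneg (Real.sqrt_nonneg _)]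
  simp_rw [← integral_const_mul]
  calc
    _ = ∫ x in Ioi (0 : ℝ), ∫ y in Ioi (0 : ℝ), f x * g y / Real.sqrt (x ^ 2 + y ^ 2) := by
      simp_rw [mul_div_assoc, add_comm]
    _ = ∫ y in Ioi (0 : ℝ), ∫ x in Ioi (0 : ℝ), f x * g y / Real.sqrt (x ^ 2 + y ^ 2) :=
      integral_integral_swap hprod
    _ = _ := by simp_rw [mul_comm (f _), mul_div_assoc]
end
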